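/- Assume r(s,a) ≤ 0 for all (s,a). Let l, u : ℝ → ℝ be non-decreasing with l(x) ≤ x ≤ u(x) for all x ∈ ℝ. Let v^{*,l}, v^{*,p}, v^{*,u} denote the unique bounded fixed points of T^l, T^p, T^u respectively. Then for all (s,z) ∈ S × ℝ, v^{*,l}(s,z) ≤ v^{*,p}(s,z) ≤ v^{*,u}(s,z). -/

import Mathlib

/-- The clamp `p(x) = max (−c) (min x c)`. -/
noncomputable def clampP (c : ℝ) (x : ℝ) : ℝ := max (-c) (min x c)

/-- The bounding operator `T^e`:
`T^e v (s, z) = max_{a ∈ A} [min 0 (r s a + z) - min 0 z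
  + γ * Σ_{s'} P(s'|s,a) * v (s', p (e ((r s a + z) / γ)))]`,
where `p` is the clamp to `[-rγ, rγ]`. `T^p` is the case `e = id`. -/
noncomputable def Te {S A : Type*} [Fintype S] [Fintype A] [Nonempty A]
    (P : S → A → PMF S) (r : S → A → ℝ) (γ rγ : ℝ) (e : ℝ → ℝ)
    (v : S × ℝ → ℝ) : S × ℝ → ℝ :=
  fun x => Finset.univ.sup' Finset.univ_nonempty fun a =>
    min 0 (r x.1 a + x.2) - min 0 x.2
      + γ * ∑ s' : S, ((P x.1 a) s').toReal *
          v (s', clampP rγ (e ((r x.1 a + x.2) / γ)))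


theorem clampP_mono (c : ℝ) : Monotone (clampP c) := fun _ _ h =>
  max_le_max le_rfl (min_le_min_right c h)

/-- For a non-positive shift `r`, the map `z ↦ min 0 (r + z) - min 0 z` is non-decreasing. -/
theorem monotone_min_zero_add_sub_min_zero {r : ℝ} (hr : r ≤ 0) :
    Monotone fun z : ℝ => min 0 (r + z) - min 0 z := by
  intro z z' h
  dsimp only
  grind

theorem PMF.sum_toReal_eq_one {S : Type*} [Fintype S] (p : PMF S) :
    ∑ s, (p s).toReal = 1 := by
  rw [← ENNReal.toReal_sum fun s _ => p.apply_ne_top s, ← tsum_fintype (L := .unconditional S),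
    p.tsum_coe, ENNReal.toReal_one]

/-- One application of the operators shrinks by `γ` any bound on the excess of `v` over `w`,
compared along `z ≤ z'`. -/
theorem Te_le_Te_add {S A : Type*} [Fintype S] [Fintype A] [Nonempty A]
    (P : S → A → PMF S) {r : S → A → ℝ} (hr : ∀ s a, r s a ≤ 0) {γ : ℝ} (hγ : 0 < γ) (c : ℝ)
    {e f : ℝ → ℝ} (hef : ∀ x y, x ≤ y → e x ≤ f y) {v w : S × ℝ → ℝ} {C : ℝ}
    (hvw : ∀ s z z', z ≤ z' → v (s, z) ≤ w (s, z') + C) (s : S) {z z' : ℝ} (hz : z ≤ z') :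
    Te P r γ c e v (s, z) ≤ Te P r γ c f w (s, z') + γ * C := by
  refine Finset.sup'_le _ _ fun a _ => ?_
  rw [← sub_le_iff_le_add]
  refine le_trans ?_ (Finset.le_sup' _ (Finset.mem_univ a))
  dsimp only
  have hreward := monotone_min_zero_add_sub_min_zero (hr s a) hz
  have hstate : clampP c (e ((r s a + z) / γ)) ≤ clampP c (f ((r s a + z') / γ)) :=
    clampP_mono c (hef _ _ (by gcongr))
  have hsum : ∑ s', ((P s a) s').toReal * v (s', clampP c (e ((r s a + z) / γ))) ≤
      ∑ s', ((P s a) s').toReal * w (s', clampP c (f ((r s a + z') / γ))) + C := by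
    calc
      _ ≤ ∑ s', ((P s a) s').toReal * (w (s', clampP c (f ((r s a + z') / γ))) + C) :=
        Finset.sum_le_sum fun s' _ =>
          mul_le_mul_of_nonneg_left (hvw s' _ _ hstate) ENNReal.toReal_nonneg
      _ = _ := by
        simp only [mul_add, Finset.sum_add_distrib]
        rw [← Finset.sum_mul, PMF.sum_toReal_eq_one, one_mul]
  have hdiscounted := mul_le_mul_of_nonneg_left hsum hγ.le
  dsimp only at hreward
  linarith

/-- Bounded fixed points of `T^e` and `T^f` are ordered, even along `z ≤ z'`, as soon as
`e x ≤ f y` whenever `x ≤ y`. -/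
theorem Te_fixedPoint_le_of_le {S A : Type*} [Fintype S] [Fintype A] [Nonempty A]
    (P : S → A → PMF S) {r : S → A → ℝ} (hr : ∀ s a, r s a ≤ 0) {γ : ℝ}
    (hγ : γ ∈ Set.Ioo (0 : ℝ) 1) (c : ℝ) {e f : ℝ → ℝ} (hef : ∀ x y, x ≤ y → e x ≤ f y)
    {v w : S × ℝ → ℝ} (hbv : ∃ M : ℝ, ∀ s z, |v (s, z)| ≤ M)
    (hbw : ∃ M : ℝ, ∀ s z, |w (s, z)| ≤ M) (hv : Te P r γ c e v = v) (hw : Te P r γ c f w = w)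
    (s : S) {z z' : ℝ} (hz : z ≤ z') : v (s, z) ≤ w (s, z') := by
  obtain ⟨M, hM⟩ := hbv
  obtain ⟨N, hN⟩ := hbw
  have hiter : ∀ n : ℕ, ∀ s z z', z ≤ z' → v (s, z) ≤ w (s, z') + γ ^ n * (M + N) := by
    intro n
    induction n with
    | zero =>
      intro s z z' _
      have h₁ := (abs_le.mp (hM s z)).2
      have h₂ := (abs_le.mp (hN s z')).1
      linarith
    | succ n ih =>
      intro s z z' hz
      have h := Te_le_Te_add P hr hγ.1 c hef ih s hz
      rw [hv, hw] at h
      rwa [pow_succ', mul_assoc]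
  have hlim : Filter.Tendsto (fun n : ℕ => w (s, z') + γ ^ n * (M + N)) Filter.atTop
      (nhds (w (s, z') + 0 * (M + N))) :=
    ((tendsto_pow_atTop_nhds_zero_of_lt_one hγ.1.le hγ.2).mul_const _).const_add _
  simpa using ge_of_tendsto' hlim fun n => hiter n s z z' hz

/-- with non-positive rewards and non-decreasing envelopes `l ≤ id ≤ u`, the
unique bounded fixed points of `T^l`, `T^p`, `T^u` are ordered pointwise. -/
theorem Te_fixedPoints_ordered
    {S A : Type*} [Fintype S] [Nonempty S] [Fintype A] [Nonempty A]
    (P : S → A → PMF S) (r : S → A → ℝ) (r_max : ℝ) (hr_max : 0 < r_max)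
    (hr : ∀ s a, |r s a| ≤ r_max) (γ : ℝ) (hγ : γ ∈ Set.Ioo (0 : ℝ) 1)
    (hr_nonpos : ∀ s a, r s a ≤ 0)
    (l u : ℝ → ℝ) (hl : Monotone l) (hu : Monotone u)
    (hlu : ∀ x : ℝ, l x ≤ x ∧ x ≤ u x)
    (vl vp vu : S × ℝ → ℝ)
    (hbl : ∃ M : ℝ, ∀ s z, |vl (s, z)| ≤ M)
    (hbp : ∃ M : ℝ, ∀ s z, |vp (s, z)| ≤ M)
    (hbu : ∃ M : ℝ, ∀ s z, |vu (s, z)| ≤ M)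
    (hfixl : Te P r γ (r_max / (1 - γ)) l vl = vl)
    (hfixp : Te P r γ (r_max / (1 - γ)) id vp = vp)
    (hfixu : Te P r γ (r_max / (1 - γ)) u vu = vu) :
    ∀ s z, vl (s, z) ≤ vp (s, z) ∧ vp (s, z) ≤ vu (s, z) := by
  intro s z
  exact ⟨Te_fixedPoint_le_of_le P hr_nonpos hγ _ (fun _ y h => (hl h).trans (hlu y).1)
      hbl hbp hfixl hfixp s le_rfl,
    Te_fixedPoint_le_of_le P hr_nonpos hγ _ (fun x _ h => (hlu x).2.trans (hu h))
      hbp hbu hfixp hfixu s le_rfl⟩
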